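/- arXiv:1801.00082 — 2 statements merged into one kernel-verified Lean document; each statement's English description precedes it below -/
import Mathlib

section
/- Let n ≥ 1, let C₁ and C₂ be real symmetric positive definite n×n matrices, let A₄ be a real symmetric n×n matrix, and let γ > 0 be a real number. Then the 2n×2n block matrix M = [[C₁, −γ⁻¹·A₄], [A₄, C₂]] is invertible. -/
open Matrix

/-- The 2n×2n block matrix `M = [[C₁, −γ⁻¹A₄], [A₄, C₂]]` is invertible when
`C₁, C₂` are symmetric positive definite, `A₄` is symmetric, and `γ > 0`. -/
theorem block_matrix_isUnit {n : ℕ} (hn : 1 ≤ n)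
    (C₁ C₂ A₄ : Matrix (Fin n) (Fin n) ℝ) (γ : ℝ) (hγ : 0 < γ)
    (hC₁ : C₁.PosDef) (hC₂ : C₂.PosDef) (hA₄ : A₄.IsSymm) :
    IsUnit (Matrix.fromBlocks C₁ (-(γ⁻¹ • A₄)) A₄ C₂) := by
  rw [← mulVec_injective_iff_isUnit, ← coe_mulVecLin, injective_iff_map_eq_zero]
  intro v hv
  obtain ⟨x, y, rfl⟩ : ∃ x y, v = Sum.elim x y :=
    ⟨v ∘ Sum.inl, v ∘ Sum.inr, (Sum.elim_comp_inl_inr v).symm⟩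
  rw [mulVecLin_apply, fromBlocks_mulVec, ← Sum.elim_zero_zero, Sum.elim_eq_iff] at hv
  simp only [Sum.elim_comp_inl, Sum.elim_comp_inr, neg_mulVec, smul_mulVec] at hv
  obtain ⟨h₁, h₂⟩ := hv
  have hsymm : x ⬝ᵥ (A₄ *ᵥ y) = y ⬝ᵥ (A₄ *ᵥ x) := by
    rw [dotProduct_mulVec, ← mulVec_transpose, hA₄.eq, dotProduct_comm]
  have e₁ : x ⬝ᵥ (C₁ *ᵥ x) = γ⁻¹ * (x ⬝ᵥ (A₄ *ᵥ y)) := by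
    rw [eq_of_sub_eq_zero ((sub_eq_add_neg _ _).trans h₁), dotProduct_smul, smul_eq_mul]
  have e₂ : y ⬝ᵥ (A₄ *ᵥ x) = -(y ⬝ᵥ (C₂ *ᵥ y)) := by
    rw [eq_neg_of_add_eq_zero_left h₂, dotProduct_neg]
  have energy : x ⬝ᵥ (C₁ *ᵥ x) + γ⁻¹ * (y ⬝ᵥ (C₂ *ᵥ y)) = 0 := by
    rw [e₁, hsymm, e₂]
    ring
  have n₁ : 0 ≤ x ⬝ᵥ (C₁ *ᵥ x) := hC₁.posSemidef.dotProduct_mulVec_nonneg x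
  have n₂ : 0 ≤ γ⁻¹ * (y ⬝ᵥ (C₂ *ᵥ y)) :=
    mul_nonneg (inv_nonneg.2 hγ.le) (hC₂.posSemidef.dotProduct_mulVec_nonneg y)
  have hx : x = 0 := by
    by_contra hx
    have : 0 < x ⬝ᵥ (C₁ *ᵥ x) := hC₁.dotProduct_mulVec_pos hx
    linarith
  have hy : y = 0 := by
    by_contra hy
    have : 0 < γ⁻¹ * (y ⬝ᵥ (C₂ *ᵥ y)) :=
      mul_pos (inv_pos.2 hγ) (hC₂.dotProduct_mulVec_pos hy)
    linarith
  rw [hx, hy, Sum.elim_zero_zero]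
end

section
/- Let n₁, n₂, n₃ ≥ 1 and let B₁ (n₁×n₁), B₂ (n₁×n₂), B₃ (n₁×n₃), B₄ (n₂×n₂), B₅ (n₂×n₃), B₆ (n₃×n₁), B₇ (n₃×n₂), B₈ (n₃×n₃) be real matrices, and let b₁ ∈ ℝ^{n₁}, b₂ ∈ ℝ^{n₂} be vectors. Assume B₁ is invertible and the Schur complement S := B₄ + B₂ᵀ·B₁⁻¹·B₂ is invertible. If vectors α ∈ ℝ^{n₁}, β ∈ ℝ^{n₂}, γ ∈ ℝ^{n₃} satisfy B₁·α + B₂·β + B₃·γ = b₁, −B₂ᵀ·α + B₄·β + B₅·γ = b₂, and B₆·α + B₇·β + B₈·γ = 0, then γ satisfies the reduced global equation (B₆·G₁ + B₇·G₂ + B₈)·γ = −(B₆·H₁ + B₇·H₂)·b − B₆·B₁⁻¹·b₁, where b := b₂ + B₂ᵀ·B₁⁻¹·b₁, G₁ := B₁⁻¹·B₂·S⁻¹·(B₅ + B₂ᵀ·B₁⁻¹·B₃) − B₁⁻¹·B₃, G₂ := −S⁻¹·(B₅ + B₂ᵀ·B₁⁻¹·B₃), H₁ := −B₁⁻¹·B₂·S⁻¹,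 and H₂ := S⁻¹. -/
open Matrix

theorem Matrix.eq_inv_mulVec_of_mulVec_eq {n R : Type*} [Fintype n] [DecidableEq n] [CommRing R]
    {A : Matrix n n R} (hA : IsUnit A) {x y : n → R} (h : A *ᵥ x = y) : x = A⁻¹ *ᵥ y := by
  rw [← h, mulVec_mulVec, nonsing_inv_mul A ((isUnit_iff_isUnit_det A).mp hA), one_mulVec]

/-- Static condensation: after eliminating `α` and `β`, the trace unknown `γ`
satisfies the reduced global equation
`(B₆G₁ + B₇G₂ + B₈)γ = −(B₆H₁ + B₇H₂)b − B₆B₁⁻¹b₁`, where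
`b = b₂ + B₂ᵀB₁⁻¹b₁`, `S = B₄ + B₂ᵀB₁⁻¹B₂`,
`G₁ = B₁⁻¹B₂S⁻¹(B₅ + B₂ᵀB₁⁻¹B₃) − B₁⁻¹B₃`,
`G₂ = −S⁻¹(B₅ + B₂ᵀB₁⁻¹B₃)`, `H₁ = −B₁⁻¹B₂S⁻¹`, and `H₂ = S⁻¹`. -/
theorem static_condensation_global_equation {n₁ n₂ n₃ : ℕ}
    (hn₁ : 1 ≤ n₁) (hn₂ : 1 ≤ n₂) (hn₃ : 1 ≤ n₃)
    (B₁ : Matrix (Fin n₁) (Fin n₁) ℝ) (B₂ : Matrix (Fin n₁) (Fin n₂) ℝ)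
    (B₃ : Matrix (Fin n₁) (Fin n₃) ℝ) (B₄ : Matrix (Fin n₂) (Fin n₂) ℝ)
    (B₅ : Matrix (Fin n₂) (Fin n₃) ℝ) (B₆ : Matrix (Fin n₃) (Fin n₁) ℝ)
    (B₇ : Matrix (Fin n₃) (Fin n₂) ℝ) (B₈ : Matrix (Fin n₃) (Fin n₃) ℝ)
    (b₁ : Fin n₁ → ℝ) (b₂ : Fin n₂ → ℝ)
    (hB₁ : IsUnit B₁) (hS : IsUnit (B₄ + B₂ᵀ * B₁⁻¹ * B₂))
    (α : Fin n₁ → ℝ) (β : Fin n₂ → ℝ) (γ : Fin n₃ → ℝ)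
    (h1 : B₁.mulVec α + B₂.mulVec β + B₃.mulVec γ = b₁)
    (h2 : -(B₂ᵀ.mulVec α) + B₄.mulVec β + B₅.mulVec γ = b₂)
    (h3 : B₆.mulVec α + B₇.mulVec β + B₈.mulVec γ = 0) :
    (B₆ * (B₁⁻¹ * B₂ * (B₄ + B₂ᵀ * B₁⁻¹ * B₂)⁻¹ * (B₅ + B₂ᵀ * B₁⁻¹ * B₃) -
             B₁⁻¹ * B₃) +
       B₇ * (-((B₄ + B₂ᵀ * B₁⁻¹ * B₂)⁻¹ * (B₅ + B₂ᵀ * B₁⁻¹ * B₃))) +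
       B₈).mulVec γ =
      -((B₆ * (-(B₁⁻¹ * B₂ * (B₄ + B₂ᵀ * B₁⁻¹ * B₂)⁻¹)) +
           B₇ * (B₄ + B₂ᵀ * B₁⁻¹ * B₂)⁻¹).mulVec
          (b₂ + (B₂ᵀ * B₁⁻¹).mulVec b₁)) -
        (B₆ * B₁⁻¹).mulVec b₁ := by
  have hα : α = B₁⁻¹ *ᵥ (b₁ - B₂ *ᵥ β - B₃ *ᵥ γ) :=
    eq_inv_mulVec_of_mulVec_eq hB₁ (by rw [← h1]; abel)
  have hβ : β = (B₄ + B₂ᵀ * B₁⁻¹ * B₂)⁻¹ *ᵥ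
      (b₂ + (B₂ᵀ * B₁⁻¹) *ᵥ b₁ - (B₅ + B₂ᵀ * B₁⁻¹ * B₃) *ᵥ γ) := by
    refine eq_inv_mulVec_of_mulVec_eq hS ?_
    rw [← h2, hα]
    simp only [add_mulVec, mulVec_sub, ← mulVec_mulVec]
    abel
  generalize (B₄ + B₂ᵀ * B₁⁻¹ * B₂)⁻¹ = T at hβ ⊢
  generalize b₂ + (B₂ᵀ * B₁⁻¹) *ᵥ b₁ = b at hβ ⊢
  generalize B₅ + B₂ᵀ * B₁⁻¹ * B₃ = C at hβ ⊢
  rw [hα, hβ] at h3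
  simp only [mulVec_sub, add_mulVec, sub_mulVec, neg_mulVec, mulVec_neg, ← mulVec_mulVec] at h3 ⊢
  rw [← sub_eq_zero, ← h3]
  abel
end
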